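/- Let d ≥ 1, let X be uniformly distributed on B_1^d, let Q(x) = P(X₁ > x) and E(x) = E[X₁ | X₁ > x], and define g⁺(x) = Q(x)² · E[X₁ − x | X₁ > x] · √(1 + E(x)²) for x ∈ (−1,1). Then for all x ∈ [3/4, 1): c_L(d) (1−x)^{d+2} ≤ g⁺(x) ≤ c_U(d) (1−x)^{d+2}, where c_L(d) = c₂(d)² · max(0, 1−c₅(d)) · (5/4) and c_U(d) = c₃(d)² · (1−c₄(d)) · √2, with c₁(d) = Γ(d/2+1)/(√π Γ((d+1)/2)), c₂(d) = (c₁(d)/(d+1))(7/4)^{(d+1)/2}, c₃(d) = (c₁(d)/(d+1)) 2^{(d+2)/2}, c₄(d) = (2(d+1)/(d+3))(7/4)^{(d−1)/2}/2^{(d+2)/2}, c₅(d) = (2(d+1)/(d+3)) 2^{(d−1)/2}/(7/4)^{(d+1)/2}. -/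

import Mathlib

open MeasureTheory Real Filter ProbabilityTheory
open scoped ENNReal Classical BigOperators

noncomputable section

abbrev Euc (d : ℕ) : Type := EuclideanSpace ℝ (Fin d)

def relu (t : ℝ) : ℝ := max t 0

abbrev ParamIx (d K : ℕ) : Type := (Fin K × Fin d) ⊕ (Fin K ⊕ (Fin K ⊕ Unit))

abbrev Params (d K : ℕ) : Type := EuclideanSpace ℝ (ParamIx d K)

/-- input-layer weight `w_k j` -/
def wP {d K : ℕ} (θ : Params d K) (k : Fin K) (j : Fin d) : ℝ := θ (Sum.inl (k, j))
/-- input-layer bias `b_k` -/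
def bP {d K : ℕ} (θ : Params d K) (k : Fin K) : ℝ := θ (Sum.inr (Sum.inl k))
/-- output-layer weight `v_k` -/
def vP {d K : ℕ} (θ : Params d K) (k : Fin K) : ℝ := θ (Sum.inr (Sum.inr (Sum.inl k)))
/-- output bias `β` -/
def betaP {d K : ℕ} (θ : Params d K) : ℝ := θ (Sum.inr (Sum.inr (Sum.inr ())))

/-- two-layer ReLU network `f_θ(x) = Σ_k v_k relu(w_kᵀ x − b_k) + β` -/
def netFun {d K : ℕ} (θ : Params d K) (x : Euc d) : ℝ :=
  (∑ k, vP θ k * relu ((∑ j, wP θ k j * x j) - bP θ k)) + betaP θ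

/-- empirical squared loss -/
def empLoss {d K : ℕ} (n : ℕ) (x : Fin n → Euc d) (y : Fin n → ℝ) (θ : Params d K) : ℝ :=
  (1 / (2 * (n : ℝ))) * ∑ i, (y i - netFun θ (x i)) ^ 2

/-- Hessian quadratic form `vᵀ ∇²L(θ) v` -/
def hessQF {E : Type*} [NormedAddCommGroup E] [NormedSpace ℝ E] (L : E → ℝ) (θ v : E) : ℝ :=
  iteratedFDeriv ℝ 2 L θ ![v, v]

/-- largest eigenvalue of the (symmetric) Hessian of `L` at `θ` -/
def lambdaMax {E : Type*} [NormedAddCommGroup E] [NormedSpace ℝ E] (L : E → ℝ) (θ : E) : ℝ :=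
  ⨆ v : {v : E // ‖v‖ = 1}, hessQF L θ v.1

/-- weighted variation seminorm -/
def VgSeminorm (d : ℕ) (R : ℝ) (g : Euc d × ℝ → ℝ) (f : Euc d → ℝ) : ℝ≥0∞ :=
  sInf { m : ℝ≥0∞ |
    ∃ (ν : MeasureTheory.SignedMeasure (Euc d × ℝ)) (c : Euc d) (c₀ : ℝ),
      ν.totalVariation ((Metric.sphere (0 : Euc d) 1 ×ˢ Set.Icc (-R) R)ᶜ) = 0 ∧
      (∀ x ∈ Metric.closedBall (0 : Euc d) R,
        f x = (∫ p : Euc d × ℝ, relu ((∑ j, p.1 j * x j) - p.2)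
                  ∂ν.toJordanDecomposition.posPart)
              - (∫ p : Euc d × ℝ, relu ((∑ j, p.1 j * x j) - p.2)
                  ∂ν.toJordanDecomposition.negPart)
              + (∑ j, c j * x j) + c₀) ∧
      m = ∫⁻ p, ENNReal.ofReal (g p) ∂ν.totalVariation }

def gTilde {d : ℕ} (n : ℕ) (x : Fin n → Euc d) (u : Euc d) (t : ℝ) : ℝ :=
  (((Finset.univ.filter fun i => t < ∑ j, u j * x i j).card : ℝ) / (n : ℝ)) ^ 2 *
    ((∑ i ∈ Finset.univ.filter fun i => t < ∑ j, u j * x i j, ((∑ j, u j * x i j) - t)) /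
      ((Finset.univ.filter fun i => t < ∑ j, u j * x i j).card : ℝ)) *
    Real.sqrt (1 + ‖(((Finset.univ.filter fun i => t < ∑ j, u j * x i j).card : ℝ))⁻¹ •
      ∑ i ∈ Finset.univ.filter fun i => t < ∑ j, u j * x i j, x i‖ ^ 2)

def gData {d : ℕ} (n : ℕ) (x : Fin n → Euc d) : Euc d × ℝ → ℝ :=
  fun p => min (gTilde n x p.1 p.2) (gTilde n x (-p.1) (-p.2))

def gPow (d : ℕ) : Euc d × ℝ → ℝ :=
  fun p => if |p.2| ≤ 1 then (1 - |p.2|) ^ (d + 2) else 0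

def uniformBall (d : ℕ) : Measure (Euc d) :=
  (volume (Metric.closedBall (0 : Euc d) 1))⁻¹ • volume.restrict (Metric.closedBall 0 1)

instance (d : ℕ) : IsProbabilityMeasure (uniformBall d) := by
  constructor
  rw [uniformBall, Measure.smul_apply, Measure.restrict_apply MeasurableSet.univ,
    Set.univ_inter, smul_eq_mul, ENNReal.inv_mul_cancel]
  · exact (Metric.measure_closedBall_pos volume (0 : Euc d) one_pos).ne'
  · exact (isCompact_closedBall _ _).measure_lt_top.ne

/-- set of stable solutions for the dataset `(x, y)` -/
def FStable (d : ℕ) (η : ℝ) {n : ℕ} (x : Fin n → Euc d) (y : Fin n → ℝ) (f : Euc d → ℝ) : Prop :=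
  ∃ (K : ℕ) (θ : Params d K),
    (∀ z, f z = netFun θ z) ∧
    ContDiffAt ℝ 2 (empLoss n x y) θ ∧
    lambdaMax (empLoss n x y) θ ≤ 2 / η

/-- membership in the (unweighted) variation ball `V_C(B_1^d)` -/
def memVC (d : ℕ) (C : ℝ) (f : Euc d → ℝ) : Prop :=
  ∃ (ν : MeasureTheory.SignedMeasure (Euc d × ℝ)) (c : Euc d) (b : ℝ),
    ν.totalVariation ((Metric.sphere (0 : Euc d) 1 ×ˢ Set.Icc (-1 : ℝ) 1)ᶜ) = 0 ∧
    ν.totalVariation Set.univ ≤ ENNReal.ofReal C ∧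
    ∀ x ∈ Metric.closedBall (0 : Euc d) 1,
      f x = (∫ p : Euc d × ℝ, relu ((∑ j, p.1 j * x j) - p.2)
                ∂ν.toJordanDecomposition.posPart)
            - (∫ p : Euc d × ℝ, relu ((∑ j, p.1 j * x j) - p.2)
                ∂ν.toJordanDecomposition.negPart)
            + (∑ j, c j * x j) + b


def c1 (d : ℕ) : ℝ := Real.Gamma ((d : ℝ) / 2 + 1) / (Real.sqrt π * Real.Gamma (((d : ℝ) + 1) / 2))

def c2 (d : ℕ) : ℝ := c1 d / ((d : ℝ) + 1) * (7 / 4) ^ (((d : ℝ) + 1) / 2)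

def c3 (d : ℕ) : ℝ := c1 d / ((d : ℝ) + 1) * 2 ^ (((d : ℝ) + 2) / 2)

def c4 (d : ℕ) : ℝ :=
  (2 * ((d : ℝ) + 1) / ((d : ℝ) + 3)) * (7 / 4) ^ (((d : ℝ) - 1) / 2) / 2 ^ (((d : ℝ) + 2) / 2)

def c5 (d : ℕ) : ℝ :=
  (2 * ((d : ℝ) + 1) / ((d : ℝ) + 3)) * 2 ^ (((d : ℝ) - 1) / 2) / (7 / 4) ^ (((d : ℝ) + 1) / 2)

/-- tail probability `Q(x) = P(X₁ > x)` -/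
def tailProb (d : ℕ) (hd : 0 < d) (x : ℝ) : ℝ :=
  ((uniformBall d) {y : Euc d | x < y ⟨0, hd⟩}).toReal

/-- conditional expectation `E[X₁ | X₁ > x]` -/
def condExpFirst (d : ℕ) (hd : 0 < d) (x : ℝ) : ℝ :=
  (∫ y in {y : Euc d | x < y ⟨0, hd⟩}, y ⟨0, hd⟩ ∂uniformBall d) / tailProb d hd x

/-- conditional expectation `E[X₁ − x | X₁ > x]` -/
def condExpShift (d : ℕ) (hd : 0 < d) (x : ℝ) : ℝ :=
  (∫ y in {y : Euc d | x < y ⟨0, hd⟩}, (y ⟨0, hd⟩ - x) ∂uniformBall d) / tailProb d hd x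

/-- the weight function `g⁺(x) = Q(x)² · E[X₁ − x | X₁ > x] · √(1 + E[X₁ | X₁ > x]²)` -/
def gPlus (d : ℕ) (hd : 0 < d) (x : ℝ) : ℝ :=
  (tailProb d hd x) ^ 2 * condExpShift d hd x *
    Real.sqrt (1 + (condExpFirst d hd x) ^ 2)

def vB (n : ℕ) : ℝ := √π ^ n / Real.Gamma ((n : ℝ) / 2 + 1)

lemma vB_pos (n : ℕ) : 0 < vB n := by
  have : 0 < Real.Gamma ((n : ℝ) / 2 + 1) := Real.Gamma_pos_of_pos (by positivity)
  unfold vB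
  positivity

lemma vol_closedBall (n : ℕ) :
    volume (Metric.closedBall (0 : Euc n) 1) = ENNReal.ofReal (vB n) := by
  rcases n with _ | n
  · rw [volume_euclideanSpace_eq_dirac]
    simp [vB]
  · rw [EuclideanSpace.volume_closedBall]
    simp [vB]

lemma vol_closedBall_sqrt (n : ℕ) (u : ℝ) (hu : 0 ≤ u) :
    volume {z : Euc n | ‖z‖ ^ 2 ≤ u} = ENNReal.ofReal (vB n * u ^ ((n : ℝ) / 2)) := by
  have h1 : {z : Euc n | ‖z‖ ^ 2 ≤ u} = Metric.closedBall 0 (√u) := by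
    ext z
    simp [Real.le_sqrt (norm_nonneg z) hu]
  rw [h1, Measure.addHaar_closedBall' _ _ (Real.sqrt_nonneg u), vol_closedBall,
    ← ENNReal.ofReal_mul (by positivity)]
  congr 1
  rw [mul_comm]
  congr 1
  rw [Real.sqrt_eq_rpow, ← Real.rpow_natCast, ← Real.rpow_mul hu]
  congr 1
  simp
  ring

def splitMap (n : ℕ) (y : Euc (n + 1)) : ℝ × Euc n := (y 0, WithLp.toLp 2 (fun j => y (Fin.succ j)))

lemma splitMap_mp (n : ℕ) : MeasurePreserving (splitMap n) volume volume := by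
  have h1 := PiLp.volume_preserving_ofLp (Fin (n + 1))
  have h2 := volume_preserving_piFinSuccAbove (fun _ : Fin (n + 1) => ℝ) 0
  have h3 := (MeasurePreserving.id (volume : Measure ℝ)).prod (PiLp.volume_preserving_toLp (Fin n))
  exact h3.comp (h2.comp h1)

lemma norm_split (n : ℕ) (y : Euc (n + 1)) :
    ‖y‖ ^ 2 = (splitMap n y).1 ^ 2 + ‖(splitMap n y).2‖ ^ 2 := by
  simp [EuclideanSpace.norm_sq_eq, splitMap, Fin.sum_univ_succ]

lemma marginal (n : ℕ) (x : ℝ) (hx : -1 ≤ x) :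
    ((volume.restrict (Metric.closedBall (0 : Euc (n + 1)) 1)).restrict
      {y : Euc (n + 1) | x < y 0}).map (fun y => y 0) =
    (volume.restrict (Set.Ioc x 1)).withDensity
      (fun t => ENNReal.ofReal (vB n * (1 - t ^ 2) ^ ((n : ℝ) / 2))) := by
  have hm : Measurable (fun y : Euc (n + 1) => y 0) := by fun_prop
  have hI : MeasurableSet {y : Euc (n + 1) | x < y 0} := hm measurableSet_Ioi
  ext s hs
  rw [Measure.map_apply hm hs, withDensity_apply _ hs,
    Measure.restrict_apply (hm hs), Measure.restrict_apply ((hm hs).inter hI),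
    Measure.restrict_restrict hs]
  have hA : MeasurableSet {p : ℝ × Euc n | p.1 ∈ s ∩ Set.Ioc x 1 ∧ p.1 ^ 2 + ‖p.2‖ ^ 2 ≤ 1} := by
    apply MeasurableSet.inter
    · exact measurable_fst (hs.inter measurableSet_Ioc)
    · exact measurableSet_le (f := fun p : ℝ × Euc n => p.1 ^ 2 + ‖p.2‖ ^ 2) (g := fun _ => 1)
        (by fun_prop) (by fun_prop)
  have h1 : ((fun y : Euc (n + 1) => y 0) ⁻¹' s ∩ {y | x < y 0}) ∩ Metric.closedBall 0 1 =
      splitMap n ⁻¹' {p : ℝ × Euc n | p.1 ∈ s ∩ Set.Ioc x 1 ∧ p.1 ^ 2 + ‖p.2‖ ^ 2 ≤ 1} := by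
    ext y
    simp only [Set.mem_inter_iff, Set.mem_preimage, Set.mem_ofPred_eq, mem_closedBall_zero_iff,
      ← norm_split, Set.mem_Ioc]
    have e : (splitMap n y).1 = y 0 := rfl
    rw [e]
    have h2 : ‖y‖ ^ 2 ≤ 1 ↔ ‖y‖ ≤ 1 := by
      rw [sq_le_one_iff₀ (norm_nonneg y)]
    rw [h2]
    constructor
    · rintro ⟨⟨a, b⟩, c⟩
      refine ⟨⟨a, b, ?_⟩, c⟩
      exact (le_abs_self _).trans ((PiLp.norm_apply_le y 0).trans c)
    · rintro ⟨⟨a, b, _⟩, c⟩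
      exact ⟨⟨a, b⟩, c⟩
  rw [h1, (splitMap_mp n).measure_preimage hA.nullMeasurableSet, Measure.volume_eq_prod,
    Measure.prod_apply hA, ← lintegral_indicator (hs.inter measurableSet_Ioc)]
  congr 1
  ext t
  by_cases ht : t ∈ s ∩ Set.Ioc x 1
  · rw [Set.indicator_of_mem ht, ← vol_closedBall_sqrt]
    · congr 1
      ext z
      simp only [Set.mem_preimage, Set.mem_ofPred_eq, ht, true_and]
      constructor <;> intro h <;> linarith
    · obtain ⟨_, h3, h4⟩ := ht
      nlinarith
  · rw [Set.indicator_of_notMem ht]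
    have h5 : (Prod.mk t ⁻¹' {p : ℝ × Euc n | p.1 ∈ s ∩ Set.Ioc x 1 ∧ p.1 ^ 2 + ‖p.2‖ ^ 2 ≤ 1}) =
        ∅ := by
      ext z
      simp only [Set.mem_preimage, Set.mem_ofPred_eq, ht, false_and, Set.mem_empty_iff_false]
    rw [h5, measure_empty]

lemma c1_eq (n : ℕ) : c1 (n + 1) = vB n / vB (n + 1) := by
  have h1 : 0 < Real.Gamma ((n : ℝ) / 2 + 1) := Real.Gamma_pos_of_pos (by positivity)
  have h2 : 0 < Real.Gamma (((n : ℝ) + 1) / 2 + 1) := Real.Gamma_pos_of_pos (by positivity)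
  have h3 : 0 < √π := by positivity
  unfold c1 vB
  push_cast
  rw [show ((n : ℝ) + 1 + 1) / 2 = (n : ℝ) / 2 + 1 by ring]
  field_simp
  ring

lemma c1_pos (n : ℕ) : 0 < c1 (n + 1) := by
  rw [c1_eq]
  exact div_pos (vB_pos _) (vB_pos _)

lemma integral_unif (n : ℕ) (x : ℝ) (hx : -1 ≤ x) (hx1 : x ≤ 1) (f : ℝ → ℝ) (hf : Measurable f) :
    ∫ y in {y : Euc (n + 1) | x < y 0}, f (y 0) ∂uniformBall (n + 1) =
      c1 (n + 1) * ∫ t in x..1, (1 - t ^ 2) ^ ((n : ℝ) / 2) * f t := by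
  have hm : Measurable (fun y : Euc (n + 1) => y 0) := by fun_prop
  rw [uniformBall, Measure.restrict_smul, integral_smul_measure,
    ← integral_map (φ := fun y : Euc (n + 1) => y 0) hm.aemeasurable hf.aestronglyMeasurable,
    marginal n x hx, integral_withDensity_eq_integral_toReal_smul (by fun_prop) (by simp),
    vol_closedBall, intervalIntegral.integral_of_le hx1, ENNReal.toReal_inv,
    ENNReal.toReal_ofReal (vB_pos _).le, c1_eq, div_eq_inv_mul (vB n), mul_assoc,
    smul_eq_mul, ← integral_const_mul (vB n)]
  congr 1
  apply setIntegral_congr_fun measurableSet_Ioc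
  intro t ht
  have h4 : 0 ≤ 1 - t ^ 2 := by nlinarith [ht.1, ht.2]
  have := vB_pos n
  simp only [smul_eq_mul]
  rw [ENNReal.toReal_ofReal (by positivity), mul_assoc]

lemma tail_eq (n : ℕ) (hd : 0 < n + 1) (x : ℝ) (hx : -1 ≤ x) (hx1 : x ≤ 1) :
    tailProb (n + 1) hd x = c1 (n + 1) * ∫ t in x..1, (1 - t ^ 2) ^ ((n : ℝ) / 2) := by
  have := integral_unif n x hx hx1 (fun _ => 1) measurable_const
  simp only [mul_one] at this
  rw [← this]
  simp [tailProb, Measure.real]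

lemma cont_w (a : ℝ) (ha : 0 ≤ a) : Continuous fun t : ℝ => (1 - t ^ 2) ^ a :=
  Continuous.rpow_const (by fun_prop) (fun _ => Or.inr ha)

lemma cont_v (a : ℝ) (ha : 0 ≤ a) : Continuous fun t : ℝ => (1 - t) ^ a :=
  Continuous.rpow_const (by fun_prop) (fun _ => Or.inr ha)

lemma w_bounds (a x : ℝ) (ha : 0 ≤ a) (hx : 3 / 4 ≤ x) (hx1 : x ≤ 1) (f : ℝ → ℝ)
    (hf : Continuous f) (hf0 : ∀ t ∈ Set.Icc x 1, 0 ≤ f t) :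
    (7 / 4) ^ a * (∫ t in x..1, (1 - t) ^ a * f t) ≤ ∫ t in x..1, (1 - t ^ 2) ^ a * f t ∧
    ∫ t in x..1, (1 - t ^ 2) ^ a * f t ≤ 2 ^ a * (∫ t in x..1, (1 - t) ^ a * f t) := by
  have h1 := cont_w a ha
  have h2 := cont_v a ha
  rw [← intervalIntegral.integral_const_mul, ← intervalIntegral.integral_const_mul]
  constructor <;> refine intervalIntegral.integral_mono_on hx1
    (Continuous.intervalIntegrable (by fun_prop) _ _)
    (Continuous.intervalIntegrable (by fun_prop) _ _) (fun t ht => ?_)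
  all_goals
    rw [← mul_assoc]
    refine mul_le_mul_of_nonneg_right ?_ (hf0 t ht)
    have h3 : 0 ≤ 1 - t := by linarith [ht.2]
    rw [← Real.mul_rpow (by norm_num) h3]
    apply Real.rpow_le_rpow _ _ ha
    · nlinarith [ht.1, ht.2]
    · nlinarith [ht.1, ht.2]

lemma J0 (a x : ℝ) (ha : 0 ≤ a) :
    ∫ t in x..1, (1 - t) ^ a = (1 - x) ^ (a + 1) / (a + 1) := by
  rw [intervalIntegral.integral_comp_sub_left (fun u : ℝ => u ^ a) 1,
    integral_rpow (Or.inl (by linarith)), sub_self, Real.zero_rpow (by linarith), sub_zero]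

lemma J1 (a x : ℝ) (ha : 0 ≤ a) (hx1 : x < 1) :
    ∫ t in x..1, (1 - t) ^ a * (t - x) = (1 - x) ^ (a + 1) * (1 - x) / ((a + 1) * (a + 2)) := by
  have h2 := cont_v a ha
  have h3 := cont_v (a + 1) (by linarith)
  have e : ∫ t in x..1, (1 - t) ^ a * (t - x) =
      ∫ t in x..1, ((1 - x) * (1 - t) ^ a - (1 - t) ^ (a + 1)) := by
    apply intervalIntegral.integral_congr
    intro t ht
    rw [Set.uIcc_of_le hx1.le] at ht
    have h4 : 0 ≤ 1 - t := by linarith [ht.2]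
    simp only
    rw [Real.rpow_add_one' h4 (by linarith)]
    ring
  rw [e, intervalIntegral.integral_sub (Continuous.intervalIntegrable (by fun_prop) _ _)
    (Continuous.intervalIntegrable (by fun_prop) _ _), intervalIntegral.integral_const_mul,
    J0 a x ha, J0 (a + 1) x (by linarith), Real.rpow_add_one (by linarith : 1 - x ≠ 0) (a + 1)]
  have : a + 1 ≠ 0 := by linarith
  have : a + 1 + 1 ≠ 0 := by linarith
  have : a + 2 ≠ 0 := by linarith
  field_simp
  ring

set_option maxHeartbeats 1000000

/-- **Asymptotic behavior of the weight function `g⁺`.** -/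
theorem weight_function_asymptotics (d : ℕ) (hd : 0 < d)
    (x : ℝ) (hx : x ∈ Set.Ico (3 / 4 : ℝ) 1) :
    (c2 d) ^ 2 * max 0 (1 - c5 d) * (5 / 4) * (1 - x) ^ (d + 2) ≤ gPlus d hd x ∧
      gPlus d hd x ≤ (c3 d) ^ 2 * (1 - c4 d) * Real.sqrt 2 * (1 - x) ^ (d + 2) := by
  obtain ⟨n, rfl⟩ : ∃ n, d = n + 1 := ⟨d - 1, by omega⟩
  obtain ⟨hx0, hx1⟩ := hx
  have hc := c1_pos n
  obtain ⟨a, hn⟩ : ∃ a : ℝ, a = (n : ℝ) / 2 := ⟨_, rfl⟩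
  have ha : 0 ≤ a := by rw [hn]; positivity
  have hna : (n : ℝ) = 2 * a := by rw [hn]; ring
  have hD : 0 < 1 - x := by linarith
  have hP : 0 < (1 - x) ^ (a + 1) := Real.rpow_pos_of_pos hD _
  have hw := cont_w a ha
  have hA : 0 < (7 / 4 : ℝ) ^ a := by positivity
  have hAB : (7 / 4 : ℝ) ^ a ≤ 2 ^ a := Real.rpow_le_rpow (by norm_num) (by norm_num) ha
  -- the three integrals
  have hQ := tail_eq n hd x (by linarith) hx1.le
  have hS : ∫ y in {y : Euc (n + 1) | x < y ⟨0, hd⟩}, (y ⟨0, hd⟩ - x) ∂uniformBall (n + 1) = _ :=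
    integral_unif n x (by linarith) hx1.le (fun t => t - x) (by fun_prop)
  have hF : ∫ y in {y : Euc (n + 1) | x < y ⟨0, hd⟩}, y ⟨0, hd⟩ ∂uniformBall (n + 1) = _ :=
    integral_unif n x (by linarith) hx1.le (fun t => t) (by fun_prop)
  rw [← hn] at hQ hS hF
  have b0 := w_bounds a x ha hx0 hx1.le (fun _ => 1) (by fun_prop) (fun _ _ => by norm_num)
  have b1 := w_bounds a x ha hx0 hx1.le (fun t => t - x) (by fun_prop)
    (fun t ht => by linarith [ht.1])
  have b2 := (w_bounds a x ha hx0 hx1.le (fun t => 1 - t) (by fun_prop)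
    (fun t ht => by linarith [ht.2])).1
  have b3 : 0 ≤ ∫ t in x..1, (1 - t) ^ a * (1 - t) :=
    intervalIntegral.integral_nonneg hx1.le (fun t ht => by
      have : 0 ≤ 1 - t := by linarith [ht.2]
      positivity)
  simp only [mul_one] at b0
  rw [J0 a x ha] at b0
  rw [J1 a x ha hx1] at b1
  have e1 : ∫ t in x..1, (1 - t ^ 2) ^ a * (t - x) =
      (∫ t in x..1, (1 - t ^ 2) ^ a * t) - x * ∫ t in x..1, (1 - t ^ 2) ^ a := by
    rw [← intervalIntegral.integral_const_mul, ← intervalIntegral.integral_sub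
      (Continuous.intervalIntegrable (by fun_prop) _ _)
      (Continuous.intervalIntegrable (by fun_prop) _ _)]
    congr 1
    ext t
    ring
  have e2 : ∫ t in x..1, (1 - t ^ 2) ^ a * (1 - t) =
      (∫ t in x..1, (1 - t ^ 2) ^ a) - ∫ t in x..1, (1 - t ^ 2) ^ a * t := by
    rw [← intervalIntegral.integral_sub
      (Continuous.intervalIntegrable (by fun_prop) _ _)
      (Continuous.intervalIntegrable (by fun_prop) _ _)]
    congr 1
    ext t
    ring
  have hJ0 : 0 < (1 - x) ^ (a + 1) / (a + 1) := by positivity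
  have hJ1 : 0 < (1 - x) ^ (a + 1) * (1 - x) / ((a + 1) * (a + 2)) := by positivity
  have hJJ : (1 - x) ^ (a + 1) / (a + 1) * ((1 - x) ^ (a + 1) * (1 - x) / ((a + 1) * (a + 2))) =
      (1 - x) ^ (n + 1 + 2) / ((a + 1) ^ 2 * (a + 2)) := by
    have : (1 - x) ^ (n + 1 + 2) = (1 - x) ^ (a + 1) * (1 - x) ^ (a + 1) * (1 - x) := by
      rw [← Real.rpow_add hD, ← Real.rpow_add_one hD.ne', ← Real.rpow_natCast]
      congr 1
      push_cast
      rw [hna]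
      ring
    rw [this]
    field_simp
  have hI0 : 0 < ∫ t in x..1, (1 - t ^ 2) ^ a := lt_of_lt_of_le (by positivity) b0.1
  have hI1 : 0 < ∫ t in x..1, (1 - t ^ 2) ^ a * (t - x) := lt_of_lt_of_le (by positivity) b1.1
  have hE : condExpFirst (n + 1) hd x =
      (∫ t in x..1, (1 - t ^ 2) ^ a * t) / ∫ t in x..1, (1 - t ^ 2) ^ a := by
    unfold condExpFirst
    rw [hF, hQ, mul_div_mul_left _ _ hc.ne']
  have hE1 : condExpFirst (n + 1) hd x ≤ 1 := by
    rw [hE, div_le_one hI0]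
    have := mul_nonneg hA.le b3
    linarith
  have hE0 : 3 / 4 ≤ condExpFirst (n + 1) hd x := by
    rw [hE, le_div_iff₀ hI0]
    have := mul_le_mul_of_nonneg_right hx0 hI0.le
    linarith
  have hG : gPlus (n + 1) hd x = c1 (n + 1) ^ 2 * ((∫ t in x..1, (1 - t ^ 2) ^ a) *
      ∫ t in x..1, (1 - t ^ 2) ^ a * (t - x)) * √(1 + condExpFirst (n + 1) hd x ^ 2) := by
    unfold gPlus condExpShift
    rw [hS, hQ]
    field_simp
  have hs0 : 5 / 4 ≤ √(1 + condExpFirst (n + 1) hd x ^ 2) := by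
    apply Real.le_sqrt_of_sq_le
    nlinarith
  have hs1 : √(1 + condExpFirst (n + 1) hd x ^ 2) ≤ √2 := by
    apply Real.sqrt_le_sqrt
    nlinarith
  have k0 := mul_le_mul b0.1 b1.1 (by positivity) hI0.le
  have k1 := mul_le_mul b0.2 b1.2 hI1.le (by positivity)
  have r0 : ((7 / 4 : ℝ) ^ a) ^ 2 * ((1 - x) ^ (n + 1 + 2) / ((a + 1) ^ 2 * (a + 2))) ≤
      (∫ t in x..1, (1 - t ^ 2) ^ a) * ∫ t in x..1, (1 - t ^ 2) ^ a * (t - x) := by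
    rw [← hJJ]
    linarith
  have r1 : (∫ t in x..1, (1 - t ^ 2) ^ a) * (∫ t in x..1, (1 - t ^ 2) ^ a * (t - x)) ≤
      ((2 : ℝ) ^ a) ^ 2 * ((1 - x) ^ (n + 1 + 2) / ((a + 1) ^ 2 * (a + 2))) := by
    rw [← hJJ]
    linarith
  have hc2 : c2 (n + 1) = c1 (n + 1) / (2 * (a + 1)) * ((7 / 4) ^ a * (7 / 4)) := by
    unfold c2
    push_cast
    rw [hna, ← Real.rpow_add_one (by norm_num)]
    congr 2 <;> ring
  have h2a : (2 : ℝ) ^ ((2 * a + 1 + 2) / 2) = 2 ^ a * 2 * √2 := by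
    rw [Real.sqrt_eq_rpow, ← Real.rpow_add_one (by norm_num), ← Real.rpow_add (by norm_num)]
    congr 1
    ring
  have hc3 : c3 (n + 1) = c1 (n + 1) / (2 * (a + 1)) * (2 ^ a * 2 * √2) := by
    unfold c3
    push_cast
    rw [hna, h2a]
    congr 2
    ring
  have hc4 : c4 (n + 1) = 2 * (a + 1) / (a + 2) * (7 / 4) ^ a / (2 ^ a * 2 * √2) := by
    unfold c4
    push_cast
    rw [hna, h2a, show (2 * a + 1 - 1) / 2 = a by ring]
    congr 2
    field_simp
    ring
  have hc5 : c5 (n + 1) = 2 * (a + 1) / (a + 2) * 2 ^ a / ((7 / 4) ^ a * (7 / 4)) := by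
    unfold c5
    push_cast
    rw [hna, show (2 * a + 1 - 1) / 2 = a by ring, ← Real.rpow_add_one (by norm_num),
      show (2 * a + 1 + 1) / 2 = a + 1 by ring]
    congr 2
    field_simp
    ring
  have hs2 : 1 ≤ √2 := Real.one_le_sqrt.mpr (by norm_num)
  have h4 : 1 / (a + 2) ≤ 1 - c4 (n + 1) := by
    have : c4 (n + 1) ≤ (a + 1) / (a + 2) := by
      rw [hc4, div_le_iff₀ (by positivity)]
      have e : (a + 1) / (a + 2) * (2 ^ a * 2 * √2) = 2 * (a + 1) / (a + 2) * (2 ^ a * √2) := by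
        ring
      rw [e]
      apply mul_le_mul_of_nonneg_left _ (by positivity)
      have := mul_le_mul_of_nonneg_left hs2 (hA.le.trans hAB)
      linarith
    have e : 1 / (a + 2) = 1 - (a + 1) / (a + 2) := by field_simp; ring
    linarith
  have h5 : max 0 (1 - c5 (n + 1)) ≤ 1 / (a + 2) := by
    have : (a + 1) / (a + 2) ≤ c5 (n + 1) := by
      rw [hc5, le_div_iff₀ (by positivity)]
      have e : (a + 1) / (a + 2) * ((7 / 4) ^ a * (7 / 4)) =
        2 * (a + 1) / (a + 2) * ((7 / 4) ^ a * (7 / 8)) := by ring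
      rw [e]
      apply mul_le_mul_of_nonneg_left _ (by positivity)
      linarith
    have e : 1 / (a + 2) = 1 - (a + 1) / (a + 2) := by field_simp; ring
    apply max_le (by positivity)
    linarith
  have hT : 0 < (1 - x) ^ (n + 1 + 2) := by positivity
  generalize (1 - x) ^ (n + 1 + 2) = T at *
  rw [hG]
  have hB : 0 < (2 : ℝ) ^ a := by positivity
  constructor
  · calc _ ≤ c2 (n + 1) ^ 2 * (1 / (a + 2)) * (5 / 4) * T := by gcongr
      _ ≤ c1 (n + 1) ^ 2 * (((7 / 4 : ℝ) ^ a) ^ 2 * (T / ((a + 1) ^ 2 * (a + 2)))) * (5 / 4) := by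
        rw [hc2]
        have e : (c1 (n + 1) / (2 * (a + 1)) * ((7 / 4) ^ a * (7 / 4))) ^ 2 * (1 / (a + 2)) *
          (5 / 4) * T = 49 / 64 * (c1 (n + 1) ^ 2 * (((7 / 4 : ℝ) ^ a) ^ 2 *
            (T / ((a + 1) ^ 2 * (a + 2)))) * (5 / 4)) := by
          field_simp
          ring
        rw [e]
        have : 0 ≤ c1 (n + 1) ^ 2 * (((7 / 4 : ℝ) ^ a) ^ 2 *
            (T / ((a + 1) ^ 2 * (a + 2)))) * (5 / 4) := by positivity
        linarith
      _ ≤ _ := by gcongr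
  · calc _ ≤ c1 (n + 1) ^ 2 * (((2 : ℝ) ^ a) ^ 2 * (T / ((a + 1) ^ 2 * (a + 2)))) * √2 := by
          gcongr
      _ ≤ c3 (n + 1) ^ 2 * (1 / (a + 2)) * √2 * T := by
        have e : c3 (n + 1) ^ 2 * (1 / (a + 2)) * √2 * T = 2 * (c1 (n + 1) ^ 2 *
            (((2 : ℝ) ^ a) ^ 2 * (T / ((a + 1) ^ 2 * (a + 2)))) * √2) := by
          rw [hc3, mul_pow, mul_pow _ (√2), Real.sq_sqrt (by norm_num)]
          field_simp
        rw [e]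
        have : 0 ≤ c1 (n + 1) ^ 2 *
            (((2 : ℝ) ^ a) ^ 2 * (T / ((a + 1) ^ 2 * (a + 2)))) * √2 := by positivity
        linarith
      _ ≤ _ := by gcongr

end
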